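/- Let configurations be functions c : ℤ → (Bool × Bool) × Bool, where (c x).1 = (cᴸ x, cᴿ x) is the matter state of cell x and (c x).2 = A x is the gauge field on the link (x, x+1). Define the extended cellular automaton T by T(c)(x) = ((A x ⊕ cᴸ (x+1), A (x-1) ⊕ cᴿ (x-1)), A x), and for g : ℤ → Bool define the gauge transformation γ_g(c)(x) = ((g x ⊕ cᴸ x, g x ⊕ cᴿ x), g x ⊕ A x ⊕ g (x+1)) (⊕ denoting xor). Then for every g : ℤ → Bool, T ∘ γ_g = γ_g ∘ T; that is, T is gauge-invariant with Z being the identity. -/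

import Mathlib

/-- The abelian gauge-extended transport cellular automaton. -/
def gaugedCA (c : ℤ → (Bool × Bool) × Bool) : ℤ → (Bool × Bool) × Bool :=
  fun x =>
    ((xor (c x).2 (c (x + 1)).1.1, xor (c (x - 1)).2 (c (x - 1)).1.2), (c x).2)

/-- The extended gauge transformation induced by a family `g : ℤ → Bool`. -/
def gaugeTransf (g : ℤ → Bool) (c : ℤ → (Bool × Bool) × Bool) :
    ℤ → (Bool × Bool) × Bool :=
  fun x =>
    ((xor (g x) (c x).1.1, xor (g x) (c x).1.2),
      xor (g x) (xor (c x).2 (g (x + 1))))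

theorem stmt_4 (g : ℤ → Bool) :
    gaugedCA ∘ gaugeTransf g = gaugeTransf g ∘ gaugedCA := by
  funext c x
  simp only [Function.comp_apply, gaugedCA, gaugeTransf, sub_add_cancel, Prod.mk.injEq, and_true]
  constructor
  · cases g x <;> cases g (x + 1) <;> cases (c x).2 <;> simp
  · cases g x <;> cases g (x - 1) <;> cases (c (x - 1)).2 <;> simp
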